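/- Let p be a prime and let h be a minimal vanishing sorou whose relative order is p. Then there is a root of unity z such that h equals the multiset {z, zν_p, zν_p^2, …, zν_p^{p−1}}; conversely, for any root of unity z and prime p, the multiset {z, zν_p, …, zν_p^{p−1}} is a minimal vanishing sorou. -/

import Mathlib

open Complex

noncomputable def nu (n : ℕ) : ℂ := Complex.exp (2 * Real.pi * Complex.I / n)

def IsRootOfUnity (z : ℂ) : Prop := ∃ n : ℕ, 0 < n ∧ z ^ n = 1

def IsSorou (h : Multiset ℂ) : Prop := h ≠ 0 ∧ ∀ z ∈ h, IsRootOfUnity z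

noncomputable def rootOrder (z : ℂ) : ℕ := sInf {d : ℕ | 0 < d ∧ z ^ d = 1}

noncomputable def sorouOrder (h : Multiset ℂ) : ℕ := (h.map rootOrder).lcm

noncomputable def relOrder (h : Multiset ℂ) : ℕ :=
  (h.bind fun a => h.map fun b => rootOrder (a / b)).lcm

def IsMinVanishing (h : Multiset ℂ) : Prop :=
  h.sum = 0 ∧ ∀ g : Multiset ℂ, g ≤ h → g ≠ 0 → g ≠ h → g.sum ≠ 0

theorem isPrimitiveRoot_nu {n : ℕ} (hn : n ≠ 0) : IsPrimitiveRoot (nu n) n :=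
  Complex.isPrimitiveRoot_exp n hn

theorem IsRootOfUnity.ne_zero {z : ℂ} (hz : IsRootOfUnity z) : z ≠ 0 := by
  obtain ⟨n, hn, h⟩ := hz
  rintro rfl
  simp [hn.ne'] at h

theorem IsRootOfUnity.mul {z w : ℂ} (hz : IsRootOfUnity z) (hw : IsRootOfUnity w) :
    IsRootOfUnity (z * w) := by
  obtain ⟨m, hm, hzm⟩ := hz
  obtain ⟨n, hn, hwn⟩ := hw
  refine ⟨m * n, Nat.mul_pos hm hn, ?_⟩
  rw [mul_pow, pow_mul, hzm, one_pow, mul_comm m n, pow_mul, hwn, one_pow, one_mul]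

theorem IsRootOfUnity.inv {z : ℂ} (hz : IsRootOfUnity z) : IsRootOfUnity z⁻¹ := by
  obtain ⟨n, hn, h⟩ := hz
  exact ⟨n, hn, by rw [inv_pow, h, inv_one]⟩

theorem IsRootOfUnity.div {z w : ℂ} (hz : IsRootOfUnity z) (hw : IsRootOfUnity w) :
    IsRootOfUnity (z / w) := by
  rw [div_eq_mul_inv]
  exact hz.mul hw.inv

theorem IsRootOfUnity.pow_rootOrder {z : ℂ} (hz : IsRootOfUnity z) : z ^ rootOrder z = 1 :=
  (Nat.sInf_mem (s := {d : ℕ | 0 < d ∧ z ^ d = 1}) hz).2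

theorem IsSorou.div_pow_relOrder {h : Multiset ℂ} (hh : IsSorou h) {a b : ℂ}
    (ha : a ∈ h) (hb : b ∈ h) : (a / b) ^ relOrder h = 1 := by
  have hdvd : rootOrder (a / b) ∣ relOrder h :=
    Multiset.dvd_lcm (Multiset.mem_bind.2 ⟨a, ha, Multiset.mem_map.2 ⟨b, hb, rfl⟩⟩)
  obtain ⟨k, hk⟩ := hdvd
  rw [hk, pow_mul, ((hh.2 a ha).div (hh.2 b hb)).pow_rootOrder, one_pow]

theorem nodup_map_mul_pow {ζ z : ℂ} {n : ℕ} (hζ : IsPrimitiveRoot ζ n) (hz : z ≠ 0) :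
    ((Multiset.range n).map (fun j => z * ζ ^ j)).Nodup := by
  refine Multiset.Nodup.map_on (fun i hi j hj hij => ?_) (Multiset.nodup_range n)
  exact hζ.pow_inj (Multiset.mem_range.1 hi) (Multiset.mem_range.1 hj) (mul_left_cancel₀ hz hij)

theorem sum_map_mul_pow_eq_zero {ζ z : ℂ} {n : ℕ} (hζ : IsPrimitiveRoot ζ n) (hn : 1 < n) :
    ((Multiset.range n).map (fun j => z * ζ ^ j)).sum = 0 := by
  rw [Multiset.sum_map_mul_left]
  exact mul_eq_zero_of_right z (hζ.geom_sum_eq_zero hn)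

/-- A nonempty vanishing sum of elements of the rotated `p`-gon contains the whole `p`-gon. -/
theorem map_mul_pow_le_of_sum_eq_zero {ζ z : ℂ} {p : ℕ} (hp : p.Prime) (hζ : IsPrimitiveRoot ζ p)
    (hz : z ≠ 0) {g : Multiset ℂ} (hg : g ≠ 0) (hsum : g.sum = 0)
    (hsub : g ⊆ (Multiset.range p).map (fun j => z * ζ ^ j)) :
    (Multiset.range p).map (fun j => z * ζ ^ j) ≤ g := by
  have hmem : ∀ a ∈ g, ∃ i : Fin p, z * ζ ^ i.val = a := fun a ha => by
    obtain ⟨i, hi, rfl⟩ := Multiset.mem_map.1 (hsub ha)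
    exact ⟨⟨i, Multiset.mem_range.1 hi⟩, rfl⟩
  have hinj : Function.Injective fun i : Fin p => z * ζ ^ i.val := fun i j hij =>
    Fin.ext (hζ.pow_inj i.isLt j.isLt (mul_left_cancel₀ hz hij))
  have hcount : ∑ i : Fin p, ((g.count (z * ζ ^ i.val) : ℤ) : ℂ) * ζ ^ i.val = 0 := by
    have hg_sum : g.sum = ∑ i : Fin p, g.count (z * ζ ^ i.val) • (z * ζ ^ i.val) := by
      rw [Finset.sum_multiset_count_of_subset g
        (Finset.univ.image fun i : Fin p => z * ζ ^ i.val) fun a ha => by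
          simpa using hmem a (Multiset.mem_toFinset.1 ha),
        Finset.sum_image hinj.injOn]
    refine (mul_eq_zero.1 ?_).resolve_left hz
    rw [← hsum, hg_sum, Finset.mul_sum]
    refine Finset.sum_congr rfl fun i _ => ?_
    rw [nsmul_eq_mul, Int.cast_natCast]
    ring
  have heq := (hζ.sum_eq_zero_iff_forall_eq_int hp
    fun i => (g.count (z * ζ ^ i.val) : ℤ)).1 hcount
  obtain ⟨a, ha⟩ := Multiset.exists_mem_of_ne_zero hg
  obtain ⟨i, rfl⟩ := hmem a ha
  refine (Multiset.le_iff_subset (nodup_map_mul_pow hζ hz)).2 fun b hb => ?_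
  obtain ⟨j, hj, rfl⟩ := Multiset.mem_map.1 hb
  have hij := heq i ⟨j, Multiset.mem_range.1 hj⟩
  have hi := Multiset.count_pos.2 ha
  exact Multiset.count_pos.1 (by simp only at hij; omega)

theorem stmt_4 (p : ℕ) (hp : p.Prime) :
    (∀ h : Multiset ℂ, IsSorou h → IsMinVanishing h → relOrder h = p →
      ∃ z : ℂ, IsRootOfUnity z ∧ h = (Multiset.range p).map (fun j => z * nu p ^ j)) ∧
    (∀ z : ℂ, IsRootOfUnity z →
      IsSorou ((Multiset.range p).map (fun j => z * nu p ^ j)) ∧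
      IsMinVanishing ((Multiset.range p).map (fun j => z * nu p ^ j))) := by
  have hν := isPrimitiveRoot_nu hp.ne_zero
  have hne : ∀ z : ℂ, (Multiset.range p).map (fun j => z * nu p ^ j) ≠ 0 := fun z h => by
    simpa [hp.ne_zero] using congrArg Multiset.card h
  refine ⟨fun h hh hmin hrel => ?_, fun z hz => ⟨⟨hne z, fun a ha => ?_⟩,
    sum_map_mul_pow_eq_zero hν hp.one_lt, fun g hle hg hgne hsum => ?_⟩⟩
  · obtain ⟨z, hzh⟩ := Multiset.exists_mem_of_ne_zero hh.1
    have hz := hh.2 z hzh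
    have : NeZero p := ⟨hp.ne_zero⟩
    have hle := map_mul_pow_le_of_sum_eq_zero hp hν hz.ne_zero hh.1 hmin.1 fun a ha => by
      have hpow := hh.div_pow_relOrder ha hzh
      rw [hrel] at hpow
      obtain ⟨i, hi, hia⟩ := hν.eq_pow_of_pow_eq_one hpow
      exact Multiset.mem_map.2 ⟨i, Multiset.mem_range.2 hi, by
        rw [hia, mul_div_cancel₀ _ hz.ne_zero]⟩
    refine ⟨z, hz, ?_⟩
    by_contra hcon
    exact hmin.2 _ hle (hne z) (Ne.symm hcon) (sum_map_mul_pow_eq_zero hν hp.one_lt)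
  · obtain ⟨j, -, rfl⟩ := Multiset.mem_map.1 ha
    refine hz.mul ⟨p, hp.pos, ?_⟩
    rw [pow_right_comm, hν.pow_eq_one, one_pow]
  · exact hgne (hle.antisymm
      (map_mul_pow_le_of_sum_eq_zero hp hν hz.ne_zero hg hsum (Multiset.subset_of_le hle)))
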